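/- The stabiliser of the standard G₂ 3-form is a compact subgroup of the general linear group: the set G₂ = {A ∈ GL(7, ℝ) : φ₀(Au, Av, Aw) = φ₀(u, v, w) for all u, v, w ∈ ℝ⁷} is a subgroup of GL(7, ℝ) which is compact as a topological space (equivalently, it is a closed and bounded subset of the 7×7 real matrices). -/

import Mathlib

/-- The alternating 3-form `dx^i ∧ dx^j ∧ dx^k` on `ℝ⁷`, evaluated on `u, v, w`. -/
noncomputable def dxdxdx (i j k : Fin 7) (u v w : Fin 7 → ℝ) : ℝ :=
  Matrix.det !![u i, u j, u k; v i, v j, v k; w i, w j, w k]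

/-- The standard `G₂` 3-form `φ₀` on `ℝ⁷`, as a trilinear function.
(Indices `1,…,7` of the paper correspond to `0,…,6` of `Fin 7`.) -/
noncomputable def phi0 (u v w : Fin 7 → ℝ) : ℝ :=
  dxdxdx 0 1 2 u v w + dxdxdx 0 3 4 u v w + dxdxdx 0 5 6 u v w + dxdxdx 1 3 5 u v w
    - dxdxdx 1 4 6 u v w - dxdxdx 2 3 6 u v w - dxdxdx 2 4 5 u v w

open Matrix in
/-- The **matrix determinant lemma** for a rank-one perturbation of the identity. -/
theorem det_one_add_vecMulVec {n : Type*} [Fintype n] [DecidableEq n] (u v : n → ℝ) :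
    (1 + vecMulVec u v).det = 1 + v ⬝ᵥ u := by
  rw [vecMulVec_eq Unit, det_one_add_replicateCol_mul_replicateRow]

open Matrix in
/-- If `u` lies in both the left and the right kernel of `M`, then `det (M + w wᵀ)` depends
on `w` only through its component along `u`. -/
theorem det_add_vecMulVec_of_kernel {n : Type*} [Fintype n] [DecidableEq n]
    (M : Matrix n n ℝ) (u w : n → ℝ) (hr : M *ᵥ u = 0) (hl : u ᵥ* M = 0) (hu : u ⬝ᵥ u ≠ 0) :
    (M + vecMulVec w w).det =
      ((u ⬝ᵥ w) / (u ⬝ᵥ u)) ^ 2 * (M + vecMulVec u u).det := by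
  set c : n → ℝ := (u ⬝ᵥ u)⁻¹ • (w - u) with hc
  have hQu : (1 + vecMulVec c u) *ᵥ u = w := by
    ext i
    rw [add_mulVec, one_mulVec, vecMulVec_mulVec]
    simp [hc]
    field_simp
    ring
  have hQM : (1 + vecMulVec c u) * M = M := by
    rw [Matrix.add_mul, Matrix.one_mul, vecMulVec_mul, hl]
    simp
  have hMQ : M * (1 + vecMulVec c u)ᵀ = M := by
    rw [transpose_add, transpose_vecMulVec, transpose_one, Matrix.mul_add, Matrix.mul_one,
      mul_vecMulVec, hr]
    simp
  have hdet : (1 + vecMulVec c u).det = (u ⬝ᵥ w) / (u ⬝ᵥ u) := by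
    rw [det_one_add_vecMulVec, hc, dotProduct_smul, dotProduct_sub, smul_eq_mul]
    field_simp
    ring
  have key : M + vecMulVec w w =
      (1 + vecMulVec c u) * (M + vecMulVec u u) * (1 + vecMulVec c u)ᵀ := by
    rw [Matrix.mul_add, Matrix.add_mul, hQM, hMQ, mul_vecMulVec, hQu, vecMulVec_mul,
      vecMul_transpose, hQu]
  rw [key, det_mul, det_mul, det_transpose, hdet]
  ring

/-- The matrix of the bilinear form `phi0 u`. -/
def phi0Matrix (u : Fin 7 → ℝ) : Matrix (Fin 7) (Fin 7) ℝ :=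
  !![0, u 2, -u 1, u 4, -u 3, u 6, -u 5;
    -u 2, 0, u 0, u 5, -u 6, -u 3, u 4;
    u 1, -u 0, 0, -u 6, -u 5, u 4, u 3;
    -u 4, -u 5, u 6, 0, u 0, u 1, -u 2;
    u 3, u 6, u 5, -u 0, 0, -u 2, -u 1;
    -u 6, u 3, -u 4, -u 1, u 2, 0, u 0;
    u 5, -u 4, -u 3, u 2, u 1, -u 0, 0]

open Matrix in
theorem phi0_eq_dotProduct (u v w : Fin 7 → ℝ) :
    phi0 u v w = v ⬝ᵥ phi0Matrix u *ᵥ w := by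
  simp only [phi0, dxdxdx, Matrix.det_fin_three, phi0Matrix, dotProduct, mulVec,
    Fin.sum_univ_seven]
  simp
  ring

open Matrix in
theorem transpose_phi0Matrix (u : Fin 7 → ℝ) : (phi0Matrix u)ᵀ = -phi0Matrix u := by
  ext i j
  fin_cases i <;> fin_cases j <;> simp [phi0Matrix]

open Matrix in
theorem phi0Matrix_mulVec_self (u : Fin 7 → ℝ) : phi0Matrix u *ᵥ u = 0 := by
  ext i
  fin_cases i <;> simp [phi0Matrix, mulVec, dotProduct, Fin.sum_univ_seven] <;> ring

open Matrix in
theorem vecMul_phi0Matrix_self (u : Fin 7 → ℝ) : u ᵥ* phi0Matrix u = 0 := by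
  rw [← mulVec_transpose, transpose_phi0Matrix, neg_mulVec, phi0Matrix_mulVec_self, neg_zero]

open Matrix in
/-- The double cross product identity on `ℝ⁷`. -/
theorem phi0Matrix_mul_self (u : Fin 7 → ℝ) :
    phi0Matrix u * phi0Matrix u = vecMulVec u u - (u ⬝ᵥ u) • 1 := by
  ext i j
  fin_cases i <;> fin_cases j <;>
    simp [phi0Matrix, Matrix.mul_apply, dotProduct, Fin.sum_univ_seven, vecMulVec_apply] <;> ring

open Matrix in
theorem sq_det_phi0Matrix_add_vecMulVec (u : Fin 7 → ℝ) (hu : u ⬝ᵥ u ≠ 0) :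
    (phi0Matrix u + vecMulVec u u).det ^ 2 = (u ⬝ᵥ u) ^ 8 := by
  have h : (phi0Matrix u + vecMulVec u u) * (phi0Matrix u + vecMulVec u u)ᵀ =
      (u ⬝ᵥ u) • (1 + vecMulVec ((u ⬝ᵥ u)⁻¹ • ((u ⬝ᵥ u) - 1) • u) u) := by
    rw [transpose_add, transpose_phi0Matrix, transpose_vecMulVec, Matrix.mul_add, Matrix.add_mul,
      Matrix.add_mul, Matrix.mul_neg, Matrix.mul_neg, phi0Matrix_mul_self, vecMulVec_mul,
      vecMul_phi0Matrix_self, mul_vecMulVec, phi0Matrix_mulVec_self, vecMulVec_mul_vecMulVec,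
      smul_add, smul_vecMulVec, smul_vecMulVec, smul_inv_smul₀ hu, sub_smul]
    simp
    abel
  have h' := congrArg det h
  rw [det_mul, det_transpose, det_smul, det_one_add_vecMulVec, dotProduct_smul, dotProduct_smul,
    smul_eq_mul, smul_eq_mul, Fintype.card_fin] at h'
  rw [sq, h']
  field_simp
  ring

/-- The predicate that a matrix preserves the standard `G₂` 3-form. -/
def PreservesPhi0 (A : Matrix (Fin 7) (Fin 7) ℝ) : Prop :=
  ∀ u v w : Fin 7 → ℝ, phi0 (A.mulVec u) (A.mulVec v) (A.mulVec w) = phi0 u v w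

open Matrix in
theorem PreservesPhi0.transpose_mul_phi0Matrix_mul {A : Matrix (Fin 7) (Fin 7) ℝ}
    (hA : PreservesPhi0 A) (u : Fin 7 → ℝ) :
    Aᵀ * phi0Matrix (A *ᵥ u) * A = phi0Matrix u := by
  ext i j
  have h := hA u (Pi.single i 1) (Pi.single j 1)
  rw [phi0_eq_dotProduct, phi0_eq_dotProduct, ← vecMul_transpose, ← dotProduct_mulVec,
    mulVec_mulVec, mulVec_mulVec] at h
  simpa using h

open Matrix in
theorem PreservesPhi0.dotProduct_mulVec_mul_abs_det {A : Matrix (Fin 7) (Fin 7) ℝ}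
    (hA : PreservesPhi0 A) (hdet : A.det ≠ 0) (u : Fin 7 → ℝ) :
    (A *ᵥ u) ⬝ᵥ (A *ᵥ u) * |A.det| = u ⬝ᵥ u := by
  rcases eq_or_ne u 0 with rfl | hu
  · simp
  have hAu : A *ᵥ u ≠ 0 := fun h => hu (eq_zero_of_mulVec_eq_zero hdet h)
  have hp : 0 < u ⬝ᵥ u := by simpa using dotProduct_star_self_pos_iff.2 hu
  have hq : 0 < (A *ᵥ u) ⬝ᵥ (A *ᵥ u) := by simpa using dotProduct_star_self_pos_iff.2 hAu
  have hcong : Aᵀ * (phi0Matrix (A *ᵥ u) + vecMulVec (A *ᵥ u) (A *ᵥ u)) * A =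
      phi0Matrix u + vecMulVec (Aᵀ *ᵥ A *ᵥ u) (Aᵀ *ᵥ A *ᵥ u) := by
    rw [Matrix.mul_add, Matrix.add_mul, hA.transpose_mul_phi0Matrix_mul, mul_vecMulVec,
      vecMulVec_mul, ← mulVec_transpose]
  have hd := congrArg det hcong
  rw [det_mul, det_mul, det_transpose, det_add_vecMulVec_of_kernel _ u _
    (phi0Matrix_mulVec_self u) (vecMul_phi0Matrix_self u) hp.ne', dotProduct_mulVec,
    vecMul_transpose] at hd
  have hu2 := sq_det_phi0Matrix_add_vecMulVec u hp.ne'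
  have hAu2 := sq_det_phi0Matrix_add_vecMulVec (A *ᵥ u) hq.ne'
  set p := u ⬝ᵥ u
  set q := (A *ᵥ u) ⬝ᵥ (A *ᵥ u)
  have h1 : q ^ 8 * A.det ^ 4 = (q / p) ^ 4 * p ^ 8 := by
    rw [← hu2, ← hAu2]
    linear_combination (congrArg (· ^ 2) hd)
  have h2 : (q * |A.det|) ^ 4 = p ^ 4 := by
    rw [mul_pow, Even.pow_abs (by decide)]
    have h3 : q ^ 4 * (q ^ 4 * A.det ^ 4) = q ^ 4 * p ^ 4 := by
      field_simp at h1
      linear_combination q ^ 4 * h1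
    exact mul_left_cancel₀ (pow_pos hq 4).ne' h3
  exact (pow_left_inj₀ (by positivity) hp.le (by norm_num)).1 h2

open Matrix in
theorem PreservesPhi0.mem_orthogonalGroup {A : Matrix (Fin 7) (Fin 7) ℝ}
    (hA : PreservesPhi0 A) (hdet : A.det ≠ 0) : A ∈ orthogonalGroup (Fin 7) ℝ := by
  have hquad := hA.dotProduct_mulVec_mul_abs_det hdet
  have hpol (u v : Fin 7 → ℝ) : (A *ᵥ u) ⬝ᵥ (A *ᵥ v) * |A.det| = u ⬝ᵥ v := by
    have h := hquad (u + v)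
    simp only [mulVec_add, add_dotProduct, dotProduct_add] at h
    rw [dotProduct_comm v u, dotProduct_comm (A *ᵥ v) (A *ᵥ u)] at h
    linear_combination (h - hquad u - hquad v) / 2
  have hmul : |A.det| • (Aᵀ * A) = 1 := by
    ext i j
    have h := hpol (Pi.single i 1) (Pi.single j 1)
    rw [← vecMul_transpose, ← dotProduct_mulVec, mulVec_mulVec] at h
    rw [Matrix.smul_apply, smul_eq_mul, mul_comm]
    simpa [Matrix.one_apply, Pi.single_apply, eq_comm] using h
  have habs : |A.det| = 1 := by
    have h := congrArg det hmul
    rw [det_smul, det_mul, det_transpose, det_one, Fintype.card_fin, ← abs_mul_abs_self] at h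
    refine (pow_eq_one_iff_of_nonneg (abs_nonneg _) (n := 9) (by norm_num)).1 ?_
    linear_combination h
  rw [mem_orthogonalGroup_iff']
  simpa [habs] using hmul

/-- The group `G₂`, as the stabiliser of `phi0` in `GL(7, ℝ)`. -/
def stabilizerPhi0 : Subgroup (Matrix.GeneralLinearGroup (Fin 7) ℝ) where
  carrier := {A | PreservesPhi0 (A : Matrix (Fin 7) (Fin 7) ℝ)}
  mul_mem' {A B} hA hB := fun u v w => by
    rw [Units.val_mul, ← Matrix.mulVec_mulVec, ← Matrix.mulVec_mulVec, ← Matrix.mulVec_mulVec,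
      hA, hB]
  one_mem' := fun u v w => by simp
  inv_mem' {A} hA := fun u v w => by
    rw [← hA]
    simp only [Matrix.mulVec_mulVec, Units.mul_inv, Matrix.one_mulVec]

theorem continuous_phi0_mulVec (u v w : Fin 7 → ℝ) :
    Continuous fun A : Matrix (Fin 7) (Fin 7) ℝ =>
      phi0 (A.mulVec u) (A.mulVec v) (A.mulVec w) := by
  simp only [phi0, dxdxdx, Matrix.det_fin_three]
  simp only [Matrix.mulVec, dotProduct, Matrix.of_apply, Matrix.cons_val]
  fun_prop

theorem isClosed_stabilizerPhi0 :
    IsClosed (stabilizerPhi0 : Set (Matrix.GeneralLinearGroup (Fin 7) ℝ)) := by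
  have h : (stabilizerPhi0 : Set (Matrix.GeneralLinearGroup (Fin 7) ℝ)) =
      ⋂ (u : Fin 7 → ℝ) (v : Fin 7 → ℝ) (w : Fin 7 → ℝ),
        {A | phi0 (A.val.mulVec u) (A.val.mulVec v) (A.val.mulVec w) = phi0 u v w} := by
    ext A
    simp only [Set.mem_iInter]
    rfl
  rw [h]
  exact isClosed_iInter fun u => isClosed_iInter fun v => isClosed_iInter fun w =>
    isClosed_eq ((continuous_phi0_mulVec u v w).comp Units.continuous_val) continuous_const

theorem isCompact_orthogonalGroup (n : Type*) [Fintype n] [DecidableEq n] :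
    IsCompact (Matrix.orthogonalGroup n ℝ : Set (Matrix n n ℝ)) := by
  have hK : IsCompact (Set.univ.pi fun _ : n => Set.univ.pi fun _ : n => Set.Icc (-1 : ℝ) 1) :=
    isCompact_univ_pi fun _ => isCompact_univ_pi fun _ => isCompact_Icc
  refine hK.of_isClosed_subset ?_ ?_
  · exact isClosed_unitary (R := Matrix n n ℝ)
  · intro A hA i _ j _
    exact abs_le.1 (entry_norm_bound_of_unitary hA i j)


/-- The stabiliser of `φ₀` is a compact subgroup of `GL(7, ℝ)`. -/
theorem g2_compact_subgroup :
    ∃ H : Subgroup (Matrix.GeneralLinearGroup (Fin 7) ℝ),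
      (H : Set (Matrix.GeneralLinearGroup (Fin 7) ℝ)) =
        {A : Matrix.GeneralLinearGroup (Fin 7) ℝ |
          ∀ u v w : Fin 7 → ℝ,
            phi0 ((A : Matrix (Fin 7) (Fin 7) ℝ).mulVec u)
              ((A : Matrix (Fin 7) (Fin 7) ℝ).mulVec v)
              ((A : Matrix (Fin 7) (Fin 7) ℝ).mulVec w) = phi0 u v w} ∧
      IsCompact (H : Set (Matrix.GeneralLinearGroup (Fin 7) ℝ)) := by
  refine ⟨stabilizerPhi0, rfl, ?_⟩
  refine (Submonoid.units_isCompact (isCompact_orthogonalGroup (Fin 7))).of_isClosed_subset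
    isClosed_stabilizerPhi0 fun A hA => ?_
  have hmem {B : Matrix.GeneralLinearGroup (Fin 7) ℝ} (hB : B ∈ stabilizerPhi0) :
      (B : Matrix (Fin 7) (Fin 7) ℝ) ∈ Matrix.orthogonalGroup (Fin 7) ℝ :=
    PreservesPhi0.mem_orthogonalGroup hB (Matrix.isUnits_det_units B).ne_zero
  exact ⟨hmem hA, hmem (inv_mem hA)⟩
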